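/- For H ∈ (1/2, 1), the sequence k ↦ ρ_k(H) (k ≥ 1) is positive and strictly decreasing; for H ∈ (0, 1/2), the sequence k ↦ ρ_k(H) (k ≥ 1) is negative and strictly increasing. -/

import Mathlib

open Real

/-- Autocovariance `ρ_k(H) = ((k+1)^{2H} − 2k^{2H} + (k−1)^{2H})/2` of fractional
Gaussian noise (for `k ≥ 1`, `H ∈ (0,1)`). -/
noncomputable def fgnRho (H : ℝ) (k : ℕ) : ℝ :=
  (((k : ℝ) + 1) ^ (2 * H) - 2 * (k : ℝ) ^ (2 * H) + ((k : ℝ) - 1) ^ (2 * H)) / 2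

/-- Second differences of `x ↦ x ^ q` with step one are positive for `q > 1`. -/
lemma second_diff_rpow_pos_of_one_lt {q x : ℝ} (hq : 1 < q) (hx : 0 ≤ x) :
    0 < (x + 2) ^ q - 2 * (x + 1) ^ q + x ^ q := by
  have h := (strictConvexOn_rpow hq).2 (Set.mem_Ici.2 hx)
    (Set.mem_Ici.2 (by linarith : (0 : ℝ) ≤ x + 2)) (by linarith)
    (by norm_num : (0 : ℝ) < 1 / 2) (by norm_num : (0 : ℝ) < 1 / 2) (by norm_num)
  simp only [smul_eq_mul] at h
  rw [show 1 / 2 * x + 1 / 2 * (x + 2) = x + 1 by ring] at h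
  linarith

/-- Second differences of `x ↦ x ^ q` with step one are negative for `0 < q < 1`. -/
lemma second_diff_rpow_neg {q x : ℝ} (hq₀ : 0 < q) (hq₁ : q < 1) (hx : 0 ≤ x) :
    (x + 2) ^ q - 2 * (x + 1) ^ q + x ^ q < 0 := by
  have h := (Real.strictConcaveOn_rpow hq₀ hq₁).2 (Set.mem_Ici.2 hx)
    (Set.mem_Ici.2 (by linarith : (0 : ℝ) ≤ x + 2)) (by linarith)
    (by norm_num : (0 : ℝ) < 1 / 2) (by norm_num : (0 : ℝ) < 1 / 2) (by norm_num)
  simp only [smul_eq_mul] at h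
  rw [show 1 / 2 * x + 1 / 2 * (x + 2) = x + 1 by ring] at h
  linarith

/-- Second differences of `x ↦ x ^ q` with step one are positive on the positive reals for
`q < 0`, by the inequality of arithmetic and geometric means. -/
lemma second_diff_rpow_pos_of_neg {q x : ℝ} (hq : q < 0) (hx : 0 < x) :
    0 < (x + 2) ^ q - 2 * (x + 1) ^ q + x ^ q := by
  have sq_half {y : ℝ} (hy : 0 < y) : y ^ q = y ^ (q / 2) * y ^ (q / 2) := by
    rw [← Real.rpow_add hy, add_halves]
  have h : ((x + 1) * (x + 1)) ^ (q / 2) < (x * (x + 2)) ^ (q / 2) :=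
    Real.rpow_lt_rpow_of_neg (by positivity) (by nlinarith) (by linarith)
  rw [Real.mul_rpow (by positivity) (by positivity),
    Real.mul_rpow (by positivity) (by positivity)] at h
  rw [sq_half hx, sq_half (by linarith : 0 < x + 1), sq_half (by linarith : 0 < x + 2)]
  nlinarith [sq_nonneg (x ^ (q / 2) - (x + 2) ^ (q / 2))]

lemma continuousOn_second_diff_rpow {p : ℝ} (hp : 0 < p) :
    ContinuousOn (fun x : ℝ ↦ (x + 2) ^ p - 2 * (x + 1) ^ p + x ^ p) (Set.Ici 0) := by
  have h := Real.continuous_rpow_const hp.le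
  exact (((h.comp (continuous_add_const 2)).sub
    (continuous_const.mul (h.comp (continuous_add_const 1)))).add h).continuousOn

lemma deriv_second_diff_rpow {p x : ℝ} (hx : 0 < x) :
    deriv (fun x : ℝ ↦ (x + 2) ^ p - 2 * (x + 1) ^ p + x ^ p) x =
      p * ((x + 2) ^ (p - 1) - 2 * (x + 1) ^ (p - 1) + x ^ (p - 1)) := by
  have h (c : ℝ) (hc : 0 ≤ c) :
      HasDerivAt (fun x : ℝ ↦ (x + c) ^ p) (p * (x + c) ^ (p - 1)) x := by
    simpa using ((hasDerivAt_id x).add_const c).rpow_const (p := p)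
      (Or.inl (by simp only [id]; positivity))
  have h₀ := h 0 le_rfl
  simp only [add_zero] at h₀
  refine ((((h 2 (by norm_num)).sub ((h 1 (by norm_num)).const_mul 2)).add h₀).congr_deriv
    ?_).deriv
  ring

lemma strictAntiOn_second_diff_rpow {p : ℝ} (hp₁ : 1 < p) (hp₂ : p < 2) :
    StrictAntiOn (fun x : ℝ ↦ (x + 2) ^ p - 2 * (x + 1) ^ p + x ^ p) (Set.Ici 0) := by
  refine strictAntiOn_of_deriv_neg (convex_Ici 0)
    (continuousOn_second_diff_rpow (by linarith)) fun x hx ↦ ?_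
  rw [interior_Ici, Set.mem_Ioi] at hx
  rw [deriv_second_diff_rpow hx]
  exact mul_neg_of_pos_of_neg (by linarith)
    (second_diff_rpow_neg (by linarith) (by linarith) hx.le)

lemma strictMonoOn_second_diff_rpow {p : ℝ} (hp₀ : 0 < p) (hp₁ : p < 1) :
    StrictMonoOn (fun x : ℝ ↦ (x + 2) ^ p - 2 * (x + 1) ^ p + x ^ p) (Set.Ici 0) := by
  refine strictMonoOn_of_deriv_pos (convex_Ici 0)
    (continuousOn_second_diff_rpow hp₀) fun x hx ↦ ?_
  rw [interior_Ici, Set.mem_Ioi] at hx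
  rw [deriv_second_diff_rpow hx]
  exact mul_pos hp₀ (second_diff_rpow_pos_of_neg (by linarith) hx)

lemma fgnRho_succ (H : ℝ) (n : ℕ) :
    fgnRho H (n + 1) =
      (((n : ℝ) + 2) ^ (2 * H) - 2 * ((n : ℝ) + 1) ^ (2 * H) + (n : ℝ) ^ (2 * H)) / 2 := by
  unfold fgnRho
  push_cast
  rw [add_sub_cancel_right, add_assoc, one_add_one_eq_two]

/-- For `H ∈ (1/2,1)` the sequence `k ↦ ρ_k(H)` (`k ≥ 1`) is positive and strictly
decreasing; for `H ∈ (0,1/2)` it is negative and strictly increasing. -/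
theorem fgnRho_monotonicity (H : ℝ) :
    (H ∈ Set.Ioo (1/2 : ℝ) 1 →
      ∀ k : ℕ, 1 ≤ k → 0 < fgnRho H k ∧ fgnRho H (k + 1) < fgnRho H k) ∧
    (H ∈ Set.Ioo (0 : ℝ) (1/2) →
      ∀ k : ℕ, 1 ≤ k → fgnRho H k < 0 ∧ fgnRho H k < fgnRho H (k + 1)) := by
  constructor
  · rintro ⟨h₁, h₂⟩ k hk
    obtain ⟨n, rfl⟩ := Nat.exists_eq_add_of_le' hk
    have hn : (n : ℝ) ∈ Set.Ici 0 := Set.mem_Ici.2 n.cast_nonneg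
    have hn' : ((n + 1 : ℕ) : ℝ) ∈ Set.Ici 0 := Set.mem_Ici.2 (n + 1).cast_nonneg
    rw [fgnRho_succ H (n + 1), fgnRho_succ H n]
    exact ⟨half_pos (second_diff_rpow_pos_of_one_lt (by linarith) hn),
      div_lt_div_of_pos_right (strictAntiOn_second_diff_rpow (by linarith) (by linarith)
        hn hn' (Nat.cast_lt.2 n.lt_succ_self)) two_pos⟩
  · rintro ⟨h₁, h₂⟩ k hk
    obtain ⟨n, rfl⟩ := Nat.exists_eq_add_of_le' hk
    have hn : (n : ℝ) ∈ Set.Ici 0 := Set.mem_Ici.2 n.cast_nonneg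
    have hn' : ((n + 1 : ℕ) : ℝ) ∈ Set.Ici 0 := Set.mem_Ici.2 (n + 1).cast_nonneg
    rw [fgnRho_succ H (n + 1), fgnRho_succ H n]
    exact ⟨div_neg_of_neg_of_pos (second_diff_rpow_neg (by linarith) (by linarith) hn) two_pos,
      div_lt_div_of_pos_right (strictMonoOn_second_diff_rpow (by linarith) (by linarith)
        hn hn' (Nat.cast_lt.2 n.lt_succ_self)) two_pos⟩
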